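/- Let (X,f) be a dynamical system. Then the following are equivalent: (1) (X,f) is multi-sensitive; (2) (K(X), f̄) is multi-sensitive; (3) (F^1(X), f̃_g) is multi-sensitive for some g ∈ D_m(I) with g⁻¹(1) = {1}; (4) (F^1(X), f̃_g) is multi-sensitive for every g ∈ D_m(I) with g⁻¹(1) = {1}. -/

import Mathlib

noncomputable section

open Set Metric

/-- The unit interval `I = [0,1]` as a subset of `ℝ`. -/
def I01 : Set ℝ := Set.Icc 0 1

/-- `g ∈ D_m(I)`: `g : I → I` is nondecreasing, right-continuous, `g 0 = 0`, `g 1 = 1`. -/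
def Dm (g : ℝ → ℝ) : Prop :=
  MonotoneOn g I01 ∧
  (∀ x ∈ I01, ContinuousWithinAt g (I01 ∩ Set.Ici x) x) ∧
  Set.MapsTo g I01 I01 ∧ g 0 = 0 ∧ g 1 = 1

/-- `ξ_g x = min g⁻¹([x,1])` (the min exists by right-continuity; `sInf` here). -/
def xiG (g : ℝ → ℝ) (x : ℝ) : ℝ := sInf {t | t ∈ I01 ∧ x ≤ g t}

/-- The `α`-cut `[A]_α` of a fuzzy set `A`. -/
def cut {X : Type*} (A : X → ℝ) (α : ℝ) : Set X := {x | α ≤ A x}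

/-- The support of a fuzzy set. -/
def supp {X : Type*} [TopologicalSpace X] (A : X → ℝ) : Set X := closure {x | 0 < A x}

/-- The `g`-cut `[A]_α^g = {x ∈ supp A : g (A x) ≥ α}`. -/
def gcut {X : Type*} [TopologicalSpace X] (g : ℝ → ℝ) (A : X → ℝ) (α : ℝ) : Set X :=
  {x | x ∈ supp A ∧ α ≤ g (A x)}

/-- `A ∈ F(X)`: an upper semicontinuous fuzzy set on `X`. -/
def IsFuzzy {X : Type*} [TopologicalSpace X] (A : X → ℝ) : Prop :=
  UpperSemicontinuous A ∧ ∀ x, A x ∈ I01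

/-- `A ∈ F_0(X)`: a nonempty (not identically 0) upper semicontinuous fuzzy set. -/
def InF0 {X : Type*} [TopologicalSpace X] (A : X → ℝ) : Prop := IsFuzzy A ∧ ∃ x, A x ≠ 0

/-- `A ∈ F^1(X)`: an upper semicontinuous fuzzy set attaining the value 1. -/
def InF1 {X : Type*} [TopologicalSpace X] (A : X → ℝ) : Prop := IsFuzzy A ∧ ∃ x, 1 ≤ A x

/-- The `g`-fuzzification `f̃_g(A)(x) = sup {g (A y) : y ∈ f⁻¹(x)}` (with `sup ∅ = 0`). -/
def fuzz {X : Type*} (f : X → X) (g : ℝ → ℝ) (A : X → ℝ) : X → ℝ :=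
  fun x => sSup ((fun y => g (A y)) '' (f ⁻¹' {x}))

open Classical in
/-- Hausdorff metric, extended by `d_H(∅,∅) = 0` and `d_H(∅,A) = diam X`. -/
def dH {X : Type*} [MetricSpace X] (A B : Set X) : ℝ :=
  if A = ∅ ∧ B = ∅ then 0
  else if A = ∅ ∨ B = ∅ then Metric.diam (Set.univ : Set X)
  else Metric.hausdorffDist A B

/-- The levelwise metric `d_∞(A,B) = sup {d_H([A]_α, [B]_α) : α ∈ (0,1]}`. -/
def dInfty {X : Type*} [MetricSpace X] (A B : X → ℝ) : ℝ :=
  sSup ((fun α => dH (cut A α) (cut B α)) '' Set.Ioc (0:ℝ) 1)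

/-- `K(X)`: the hyperspace of nonempty compact subsets of `X`. -/
def Kc (X : Type*) [MetricSpace X] : Set (Set X) := {A | IsCompact A ∧ A.Nonempty}

section Dyn

variable {Y : Type*}

/-- `U` is a (relatively) open subset of the space `(S, ρ)`. -/
def IsOpenIn (S : Set Y) (ρ : Y → Y → ℝ) (U : Set Y) : Prop :=
  U ⊆ S ∧ ∀ x ∈ U, ∃ ε > 0, ∀ y ∈ S, ρ x y < ε → y ∈ U

/-- Diameter of a set with respect to the distance function `ρ`. -/
def diamIn (ρ : Y → Y → ℝ) (U : Set Y) : ℝ := sSup (Set.image2 ρ U U)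

/-- Sensitive dependence on initial conditions of `T` on the space `(S, ρ)`. -/
def SensitiveOn (S : Set Y) (ρ : Y → Y → ℝ) (T : Y → Y) : Prop :=
  ∃ δ > 0, ∀ x ∈ S, ∀ ε > 0, ∃ y ∈ S, ρ x y < ε ∧ ∃ n : ℕ, δ < ρ (T^[n] x) (T^[n] y)

/-- `𝓕`-sensitivity of `T` on the space `(S, ρ)`. -/
def FSensitiveOn (S : Set Y) (ρ : Y → Y → ℝ) (T : Y → Y) (F : Set (Set ℕ)) : Prop :=
  ∃ ε > 0, ∀ U : Set Y, IsOpenIn S ρ U → U.Nonempty →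
    {n : ℕ | ε < diamIn ρ (T^[n] '' U)} ∈ F

/-- Multi-sensitivity of `T` on the space `(S, ρ)`. -/
def MultiSensitiveOn (S : Set Y) (ρ : Y → Y → ℝ) (T : Y → Y) : Prop :=
  ∃ ε > 0, ∀ (k : ℕ) (U : Fin k → Set Y),
    (∀ i, IsOpenIn S ρ (U i) ∧ (U i).Nonempty) →
    ∃ n : ℕ, ∀ i, ε < diamIn ρ (T^[n] '' U i)

/-- Topological transitivity of `T` on the space `(S, ρ)`. -/
def TransitiveOn (S : Set Y) (ρ : Y → Y → ℝ) (T : Y → Y) : Prop :=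
  ∀ U V : Set Y, IsOpenIn S ρ U → U.Nonempty → IsOpenIn S ρ V → V.Nonempty →
    ∃ n : ℕ, ((T^[n] '' U) ∩ V).Nonempty

/-- Weak mixing: `T × T` is transitive on `(S × S, max-metric)`. -/
def WeaklyMixingOn (S : Set Y) (ρ : Y → Y → ℝ) (T : Y → Y) : Prop :=
  TransitiveOn (S ×ˢ S) (fun p q => max (ρ p.1 q.1) (ρ p.2 q.2)) (Prod.map T T)

end Dyn

/-- A (proper) Furstenberg family on `ℤ⁺ = ℕ`. -/
def FurstenbergFamily (F : Set (Set ℕ)) : Prop :=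
  (∀ F1 F2 : Set ℕ, F1 ∈ F → F1 ⊆ F2 → F2 ∈ F) ∧ Set.univ ∈ F ∧ ∅ ∉ F


section Diam

variable {Y : Type*} {ρ : Y → Y → ℝ}

theorem lt_diamIn {V : Set Y} {M ε : ℝ} (hM : ∀ a b, ρ a b ≤ M) {a b : Y}
    (ha : a ∈ V) (hb : b ∈ V) (h : ε < ρ a b) : ε < diamIn ρ V := by
  refine h.trans_le (le_csSup ⟨M, ?_⟩ (mem_image2_of_mem ha hb))
  rintro _ ⟨x, -, y, -, rfl⟩
  exact hM x y

theorem exists_of_lt_diamIn {V : Set Y} {ε : ℝ} (hε : 0 < ε) (h : ε < diamIn ρ V) :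
    ∃ a ∈ V, ∃ b ∈ V, ε < ρ a b := by
  have hne : (Set.image2 ρ V V).Nonempty := by
    by_contra hcon
    rw [Set.not_nonempty_iff_eq_empty] at hcon
    rw [diamIn, hcon, Real.sSup_empty] at h
    exact lt_asymm h hε
  obtain ⟨_, ⟨a, ha, b, hb, rfl⟩, hlt⟩ := exists_lt_of_lt_csSup hne h
  exact ⟨a, ha, b, hb, hlt⟩

end Diam

section Hausdorff

variable {X : Type*} [MetricSpace X]

theorem dH_of_nonempty {A B : Set X} (hA : A.Nonempty) (hB : B.Nonempty) :
    dH A B = hausdorffDist A B := by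
  simp [dH, hA.ne_empty, hB.ne_empty]

theorem dInfty_le {A B : X → ℝ} {r : ℝ}
    (h : ∀ α ∈ Set.Ioc (0:ℝ) 1, dH (cut A α) (cut B α) ≤ r) : dInfty A B ≤ r := by
  refine csSup_le ⟨_, mem_image_of_mem _ (right_mem_Ioc.2 one_pos)⟩ ?_
  rintro _ ⟨α, hα, rfl⟩
  exact h α hα

variable [CompactSpace X]

theorem dist_le_diam_univ (x y : X) : dist x y ≤ Metric.diam (Set.univ : Set X) :=
  dist_le_diam_of_mem isCompact_univ.isBounded (mem_univ x) (mem_univ y)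

theorem dH_le_diam_univ (A B : Set X) : dH A B ≤ Metric.diam (Set.univ : Set X) := by
  rcases A.eq_empty_or_nonempty with rfl | hA
  · unfold dH
    split_ifs <;> simp_all [Metric.diam_nonneg]
  rcases B.eq_empty_or_nonempty with rfl | hB
  · simp [dH, hA.ne_empty]
  rw [dH_of_nonempty hA hB]
  obtain ⟨a, ha⟩ := hA
  obtain ⟨b, hb⟩ := hB
  exact hausdorffDist_le_of_mem_dist Metric.diam_nonneg
    (fun x _ => ⟨b, hb, dist_le_diam_univ _ _⟩) (fun x _ => ⟨a, ha, dist_le_diam_univ _ _⟩)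

theorem hausdorffEDist_ne_top_of_nonempty {A B : Set X} (hA : A.Nonempty) (hB : B.Nonempty) :
    hausdorffEDist A B ≠ ⊤ :=
  hausdorffEDist_ne_top_of_nonempty_of_bounded hA hB
    (isCompact_univ.isBounded.subset (subset_univ _))
    (isCompact_univ.isBounded.subset (subset_univ _))

theorem exists_dist_lt_of_dH_lt {A B : Set X} (hA : A.Nonempty) (hB : B.Nonempty) {r : ℝ}
    (h : dH A B < r) {y : X} (hy : y ∈ B) : ∃ x ∈ A, dist x y < r := by
  rw [dH_of_nonempty hA hB] at h
  exact exists_dist_lt_of_hausdorffDist_lt' hy h (hausdorffEDist_ne_top_of_nonempty hA hB)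

theorem le_dH_of_forall_le_dist {A B : Set X} (hB : B.Nonempty) {r : ℝ} {p : X}
    (hp : p ∈ A) (h : ∀ q ∈ B, r ≤ dist p q) : r ≤ dH A B := by
  rw [dH_of_nonempty ⟨p, hp⟩ hB]
  exact ((le_infDist hB).2 fun {q} hq => h q hq).trans
    (infDist_le_hausdorffDist_of_mem hp (hausdorffEDist_ne_top_of_nonempty ⟨p, hp⟩ hB))

/-- Nonempty subsets of `V` at Hausdorff distance `> ε` force `V` to have diameter `> ε / 2`. -/
theorem half_lt_diamIn_of_lt_dH {A B V : Set X} (hA : A.Nonempty) (hB : B.Nonempty)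
    (hAV : A ⊆ V) (hBV : B ⊆ V) {ε : ℝ} (hε : 0 < ε) (h : ε < dH A B) :
    ε / 2 < diamIn dist V := by
  by_contra! hcon
  have hle : ∀ x ∈ V, ∀ y ∈ V, dist x y ≤ ε / 2 := by
    intro x hx y hy
    by_contra! hlt
    exact (lt_diamIn dist_le_diam_univ hx hy hlt).not_ge hcon
  rw [dH_of_nonempty hA hB] at h
  have := hausdorffDist_le_of_mem_dist (s := A) (t := B) (half_pos hε).le
    (fun x hx => hB.elim fun b hb => ⟨b, hb, hle _ (hAV hx) _ (hBV hb)⟩)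
    (fun x hx => hA.elim fun a ha => ⟨a, ha, hle _ (hBV hx) _ (hAV ha)⟩)
  linarith

theorem bddAbove_dH_cut (A B : X → ℝ) :
    BddAbove ((fun α => dH (cut A α) (cut B α)) '' Set.Ioc (0:ℝ) 1) := by
  refine ⟨Metric.diam (Set.univ : Set X), ?_⟩
  rintro _ ⟨α, -, rfl⟩
  exact dH_le_diam_univ _ _

theorem dH_cut_le_dInfty (A B : X → ℝ) {α : ℝ} (hα : α ∈ Set.Ioc (0:ℝ) 1) :
    dH (cut A α) (cut B α) ≤ dInfty A B :=
  le_csSup (bddAbove_dH_cut A B) (mem_image_of_mem _ hα)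

theorem dInfty_le_diam_univ (A B : X → ℝ) : dInfty A B ≤ Metric.diam (Set.univ : Set X) :=
  dInfty_le fun _ _ => dH_le_diam_univ _ _

end Hausdorff

section Fuzzy

open Classical in
/-- The fuzzy set obtained from `A` by capping it at level `c` and raising it to `1` on `D`. -/
def capRaise {X : Type*} (A : X → ℝ) (c : ℝ) (D : Set X) : X → ℝ := fun x => if x ∈ D then 1 else min (A x) c

theorem le_capRaise_iff {X : Type*} {A : X → ℝ} {c : ℝ} {D : Set X} {α : ℝ} {x : X} :
    α ≤ capRaise A c D x ↔ (x ∈ D ∧ α ≤ 1) ∨ (x ∉ D ∧ α ≤ A x ∧ α ≤ c) := by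
  unfold capRaise
  split_ifs with h <;> simp [h]

variable {X : Type*} [MetricSpace X]

theorem InF1.cut_nonempty {A : X → ℝ} (hA : InF1 A) {α : ℝ} (hα : α ≤ 1) : (cut A α).Nonempty :=
  hA.2.imp fun _ hx => hα.trans hx

theorem IsFuzzy.isClosed_cut {A : X → ℝ} (hA : IsFuzzy A) (α : ℝ) : IsClosed (cut A α) :=
  upperSemicontinuous_iff_isClosed_preimage.1 hA.1 α

theorem InF1.capRaise {A : X → ℝ} (hA : InF1 A) {c : ℝ} (hc : 0 ≤ c) {D : Set X}
    (hD : IsClosed D) (hDne : D.Nonempty) : InF1 (_root_.capRaise A c D) := by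
  refine ⟨⟨upperSemicontinuous_iff_isClosed_preimage.2 fun α => ?_, fun x => ⟨?_, ?_⟩⟩, ?_⟩
  · rcases le_or_gt α 1 with h1 | h1
    · rcases le_or_gt α c with hαc | hαc
      · convert hD.union (hA.1.isClosed_cut α) using 1
        ext x
        by_cases hx : x ∈ D <;> simp [le_capRaise_iff, cut, hx, h1, hαc]
      · convert hD using 1
        ext x
        simp [le_capRaise_iff, h1, hαc]
    · convert isClosed_empty (X := X)
      ext x
      have : A x < α := (hA.1.2 x).2.trans_lt h1
      simp [le_capRaise_iff, h1, this]
  · rw [le_capRaise_iff]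
    by_cases hx : x ∈ D <;> simp [hx, hc, (hA.1.2 x).1]
  · unfold _root_.capRaise
    split_ifs
    exacts [le_rfl, (min_le_left _ _).trans (hA.1.2 x).2]
  · obtain ⟨d, hd⟩ := hDne
    exact ⟨d, le_capRaise_iff.2 (Or.inl ⟨hd, le_rfl⟩)⟩

theorem Dm.upperSemicontinuous_comp {g : ℝ → ℝ} (hg : Dm g) {A : X → ℝ} (hA : IsFuzzy A) :
    UpperSemicontinuous fun x => g (A x) := by
  intro x y hy
  obtain ⟨r, hr, hball⟩ := Metric.mem_nhdsWithin_iff.1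
    ((hg.2.1 _ (hA.2 x)).eventually (gt_mem_nhds hy))
  have hx := hA.2 x
  have hu : min (A x + r / 2) 1 ∈ I01 := ⟨le_min (by linarith [hx.1]) zero_le_one, min_le_right _ _⟩
  have hxu : A x ≤ min (A x + r / 2) 1 := le_min (by linarith) hx.2
  have hlt : g (min (A x + r / 2) 1) < y := by
    refine hball ⟨?_, hu, hxu⟩
    rw [Metric.mem_ball, Real.dist_eq, abs_of_nonneg (by linarith)]
    linarith [min_le_left (A x + r / 2) 1]
  filter_upwards [hA.1 x (A x + r / 2) (by linarith)] with z hz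
  exact (hg.1 (hA.2 z) hu (le_min hz.le (hA.2 z).2)).trans_lt hlt

theorem Dm.bddAbove_image {g : ℝ → ℝ} (hg : Dm g) {A : X → ℝ} (hA : IsFuzzy A) (s : Set X) :
    BddAbove ((fun y => g (A y)) '' s) := by
  refine ⟨1, ?_⟩
  rintro _ ⟨y, -, rfl⟩
  exact (hg.2.2.1 (hA.2 y)).2

theorem fuzz_mem_I01 {f : X → X} {g : ℝ → ℝ} (hg : Dm g) {A : X → ℝ} (hA : IsFuzzy A) (x : X) :
    fuzz f g A x ∈ I01 := by
  constructor
  · apply Real.sSup_nonneg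
    rintro _ ⟨y, -, rfl⟩
    exact (hg.2.2.1 (hA.2 y)).1
  · apply Real.sSup_le _ zero_le_one
    rintro _ ⟨y, -, rfl⟩
    exact (hg.2.2.1 (hA.2 y)).2

variable [CompactSpace X] {f : X → X}

theorem le_fuzz_iff (hf : Continuous f) {g : ℝ → ℝ} (hg : Dm g) {A : X → ℝ}
    (hA : IsFuzzy A) {α : ℝ} (hα : 0 < α) (x : X) :
    α ≤ fuzz f g A x ↔ ∃ y, f y = x ∧ α ≤ g (A y) := by
  constructor
  · intro h
    have hne : (f ⁻¹' {x}).Nonempty := by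
      by_contra hcon
      rw [Set.not_nonempty_iff_eq_empty] at hcon
      rw [fuzz, hcon, image_empty, Real.sSup_empty] at h
      exact hα.not_ge h
    obtain ⟨y, hy, hmax⟩ := ((hg.upperSemicontinuous_comp hA).upperSemicontinuousOn
      (f ⁻¹' {x})).exists_isMaxOn hne (isClosed_singleton.preimage hf).isCompact
    refine ⟨y, hy, h.trans (csSup_le (hne.image _) ?_)⟩
    rintro _ ⟨z, hz, rfl⟩
    exact hmax hz
  · rintro ⟨y, hy, hle⟩
    exact hle.trans (le_csSup (hg.bddAbove_image hA _) ⟨y, hy, rfl⟩)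

theorem InF1.fuzz (hf : Continuous f) {g : ℝ → ℝ} (hg : Dm g) {A : X → ℝ} (hA : InF1 A) :
    InF1 (fuzz f g A) := by
  refine ⟨⟨upperSemicontinuous_iff_isClosed_preimage.2 fun α => ?_, fuzz_mem_I01 hg hA.1⟩, ?_⟩
  · rcases le_or_gt α 0 with hα | hα
    · convert isClosed_univ (X := X)
      exact eq_univ_of_forall fun x => hα.trans (fuzz_mem_I01 hg hA.1 x).1
    · have hcut : _root_.fuzz f g A ⁻¹' Ici α = f '' ((fun y => g (A y)) ⁻¹' Ici α) := by
        ext x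
        simp only [mem_preimage, mem_Ici, le_fuzz_iff hf hg hA.1 hα, mem_image]
        exact exists_congr fun _ => and_comm
      rw [hcut]
      exact ((upperSemicontinuous_iff_isClosed_preimage.1
        (hg.upperSemicontinuous_comp hA.1) α).isCompact.image hf).isClosed
  · obtain ⟨x, hx⟩ := hA.2
    have hx1 : A x = 1 := le_antisymm (hA.1.2 x).2 hx
    exact ⟨f x, (le_fuzz_iff hf hg hA.1 one_pos _).2 ⟨x, rfl, by rw [hx1, hg.2.2.2.2]⟩⟩

theorem InF1.iterate_fuzz (hf : Continuous f) {g : ℝ → ℝ} (hg : Dm g) {A : X → ℝ} (hA : InF1 A)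
    (n : ℕ) : InF1 ((_root_.fuzz f g)^[n] A) := by
  induction n with
  | zero => exact hA
  | succ n ih =>
    rw [Function.iterate_succ_apply']
    exact ih.fuzz hf hg

theorem exists_pos_of_iterate_fuzz_pos (hf : Continuous f) {g : ℝ → ℝ} (hg : Dm g) {A : X → ℝ}
    (hA : InF1 A) (n : ℕ) {x : X} (hx : 0 < (fuzz f g)^[n] A x) :
    ∃ z, f^[n] z = x ∧ 0 < A z := by
  induction n generalizing x with
  | zero => exact ⟨x, rfl, hx⟩
  | succ n ih =>
    have hn := hA.iterate_fuzz hf hg n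
    rw [Function.iterate_succ_apply'] at hx
    obtain ⟨y, rfl, hy⟩ := (le_fuzz_iff hf hg hn.1 hx x).1 le_rfl
    have hpos : 0 < (fuzz f g)^[n] A y := by
      refine lt_of_le_of_ne (hn.1.2 y).1 fun h0 => ?_
      rw [← h0, hg.2.2.2.1] at hy
      exact hx.not_ge hy
    obtain ⟨z, rfl, hz⟩ := ih hpos
    exact ⟨z, Function.iterate_succ_apply' _ _ _, hz⟩

theorem cut_one_iterate_fuzz (hf : Continuous f) {g : ℝ → ℝ} (hg : Dm g)
    (hg1 : ∀ t ∈ I01, (g t = 1 ↔ t = 1)) {A : X → ℝ} (hA : InF1 A) (n : ℕ) :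
    cut ((fuzz f g)^[n] A) 1 = f^[n] '' cut A 1 := by
  induction n with
  | zero => simp
  | succ n ih =>
    have hn := (hA.iterate_fuzz hf hg n).1
    rw [Function.iterate_succ_apply', Function.iterate_succ', image_comp, ← ih]
    ext x
    simp only [cut, mem_ofPred_eq, le_fuzz_iff hf hg hn one_pos, mem_image]
    refine exists_congr fun y => and_comm.trans (and_congr_left fun _ => ?_)
    have hy := hn.2 y
    exact ⟨fun h => ((hg1 _ hy).1 (le_antisymm (hg.2.2.1 hy).2 h)).ge,
      fun h => ((hg1 _ hy).2 (le_antisymm hy.2 h)).ge⟩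

/-- Cuts of high level stay close to the `1`-cut. -/
theorem InF1.exists_cut_near_cut_one {A : X → ℝ} (hA : InF1 A) {δ : ℝ} (hδ : 0 < δ) :
    ∃ c ∈ Set.Ico (0:ℝ) 1, ∀ x, c < A x → ∃ y ∈ cut A 1, dist x y < δ := by
  rcases (Metric.thickening δ (cut A 1))ᶜ.eq_empty_or_nonempty with h | h
  · refine ⟨0, ⟨le_rfl, one_pos⟩, fun x _ => Metric.mem_thickening_iff.1 ?_⟩
    rw [compl_empty_iff] at h
    exact h ▸ mem_univ x
  · obtain ⟨m, hm, hmax⟩ := (hA.1.1.upperSemicontinuousOn _).exists_isMaxOn h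
      Metric.isOpen_thickening.isClosed_compl.isCompact
    refine ⟨A m, ⟨(hA.1.2 m).1, not_le.1 fun h1 => hm (self_subset_thickening hδ _ h1)⟩,
      fun x hx => Metric.mem_thickening_iff.1 ?_⟩
    by_contra hx'
    exact hx.not_ge (hmax hx')

end Fuzzy

theorem dm_id : Dm id :=
  ⟨monotoneOn_id, fun _ _ => continuousWithinAt_id, mapsTo_id _, rfl, rfl⟩

section MultiSensitive

/-- Multi-sensitivity with respect to a family of open sets indexed by any finite type. -/
theorem MultiSensitiveOn.exists_forall_fintype {Y : Type*} {S : Set Y} {ρ : Y → Y → ℝ} {T : Y → Y}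
    (h : MultiSensitiveOn S ρ T) : ∃ ε > 0, ∀ (ι : Type) [Fintype ι] (U : ι → Set Y),
      (∀ i, IsOpenIn S ρ (U i) ∧ (U i).Nonempty) → ∃ n : ℕ, ∀ i, ε < diamIn ρ (T^[n] '' U i) := by
  obtain ⟨ε, hε, h⟩ := h
  refine ⟨ε, hε, fun ι _ U hU => ?_⟩
  obtain ⟨n, hn⟩ := h _ (fun j => U ((Fintype.equivFin ι).symm j)) fun j => hU _
  exact ⟨n, fun i => by simpa using hn (Fintype.equivFin ι i)⟩

variable {X : Type*} [MetricSpace X]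

theorem isOpenIn_univ_ball (x : X) (r : ℝ) : IsOpenIn univ dist (ball x r) := by
  refine ⟨subset_univ _, fun y hy => ?_⟩
  obtain ⟨ε, hε, hsub⟩ := Metric.isOpen_iff.1 isOpen_ball y hy
  exact ⟨ε, hε, fun z _ hz => hsub (mem_ball'.2 hz)⟩

theorem IsOpenIn.isOpen {U : Set X} (hU : IsOpenIn univ dist U) : IsOpen U :=
  Metric.isOpen_iff.2 fun x hx =>
    let ⟨ε, hε, h⟩ := hU.2 x hx
    ⟨ε, hε, fun y hy => h y (mem_univ y) (mem_ball'.1 hy)⟩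

theorem exists_dist_ge_of_lt_diamIn {V : Set X} {ε : ℝ} (hε : 0 < ε) (h : ε < diamIn dist V)
    (p : X) : ∃ q ∈ V, ε / 2 ≤ dist p q := by
  by_contra! hcon
  obtain ⟨a, ha, b, hb, hab⟩ := exists_of_lt_diamIn hε h
  have := dist_triangle_left a b p
  linarith [hcon a ha, hcon b hb]

theorem exists_lt_dH_cut_of_lt_dInfty {A B : X → ℝ} {r : ℝ} (h : r < dInfty A B) :
    ∃ α ∈ Set.Ioc (0:ℝ) 1, r < dH (cut A α) (cut B α) := by
  by_contra! hcon
  exact h.not_ge (dInfty_le hcon)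

theorem inF1_indicator_singleton (x : X) : InF1 (Set.indicator {x} fun _ => (1 : ℝ)) := by
  refine ⟨⟨isClosed_singleton.upperSemicontinuous_indicator zero_le_one, fun y => ?_⟩, x, by simp⟩
  by_cases hy : y = x <;> simp [I01, hy]

variable [CompactSpace X] {f : X → X}

/-- Under multi-sensitivity, finitely many compact sets can be simultaneously approximated by finite
sets whose images at some common time are uniformly far from the images of the given sets. -/
theorem MultiSensitiveOn.exists_finite_approx (h : MultiSensitiveOn (univ : Set X) dist f) :
    ∃ ε > 0, ∀ (k : ℕ) (C : Fin k → Set X) (δ : Fin k → ℝ),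
      (∀ i, IsCompact (C i) ∧ (C i).Nonempty) → (∀ i, 0 < δ i) →
      ∃ (n : ℕ) (D : Fin k → Set X), ∀ i, (D i).Finite ∧ (D i).Nonempty ∧
        (∀ x ∈ C i, ∃ y ∈ D i, dist x y ≤ δ i) ∧ (∀ y ∈ D i, ∃ x ∈ C i, dist y x ≤ δ i) ∧
        ε < dH (f^[n] '' C i) (f^[n] '' D i) := by
  obtain ⟨ε, hε, h⟩ := h.exists_forall_fintype
  refine ⟨ε / 4, by positivity, fun k C δ hC hδ => ?_⟩
  choose t htC htfin htcov using fun i =>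
    (hC i).1.finite_cover_balls (half_pos (hδ i))
  choose p hp using fun i => (hC i).2
  have hfin : ∀ i, Finite (t i) := fun i => (htfin i).to_subtype
  have hN : ∀ i, ∃ N : ℕ, Nonempty (t i ≃ Fin N) := fun i => Finite.exists_equiv_fin _
  choose N e using hN
  obtain ⟨n, hn⟩ := h (Σ i, Fin (N i))
    (fun j => ball (((e j.1).some.symm j.2 : t j.1) : X) (δ j.1 / 2))
    fun j => ⟨isOpenIn_univ_ball _ _, ⟨_, mem_ball_self (half_pos (hδ j.1))⟩⟩
  have key : ∀ i (x : t i), ∃ z : X, dist z x < δ i / 2 ∧ ε / 2 ≤ dist (f^[n] (p i)) (f^[n] z) := by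
    intro i x
    obtain ⟨_, ⟨z, hz, rfl⟩, hle⟩ :=
      exists_dist_ge_of_lt_diamIn hε (hn ⟨i, (e i).some x⟩) (f^[n] (p i))
    simp only [Equiv.symm_apply_apply] at hz
    exact ⟨z, hz, hle⟩
  choose z hz hfar using key
  have hnear : ∀ i, ∀ x ∈ C i, ∃ y ∈ range (z i), dist x y ≤ δ i := by
    intro i x hx
    obtain ⟨a, ha, hxa⟩ := mem_iUnion₂.1 (htcov i hx)
    refine ⟨_, ⟨⟨a, ha⟩, rfl⟩, ?_⟩
    have := dist_triangle_right x (z i ⟨a, ha⟩) a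
    linarith [mem_ball.1 hxa, hz i ⟨a, ha⟩]
  have hne : ∀ i, (range (z i)).Nonempty := fun i =>
    let ⟨y, hy, _⟩ := hnear i _ (hp i)
    ⟨y, hy⟩
  refine ⟨n, fun i => range (z i), fun i => ⟨finite_range _, hne i, hnear i, ?_, ?_⟩⟩
  · rintro _ ⟨x, rfl⟩
    exact ⟨x, htC i x.2, by linarith [hz i x, hδ i]⟩
  · refine lt_of_lt_of_le (by linarith : ε / 4 < ε / 2)
      (le_dH_of_forall_le_dist ((hne i).image _) (mem_image_of_mem _ (hp i)) ?_)
    rintro _ ⟨_, ⟨x, rfl⟩, rfl⟩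
    exact hfar i x

theorem MultiSensitiveOn.image (h : MultiSensitiveOn (univ : Set X) dist f) :
    MultiSensitiveOn (Kc X) dH (Set.image f) := by
  obtain ⟨ε, hε, h⟩ := h.exists_finite_approx
  refine ⟨ε, hε, fun k U hU => ?_⟩
  choose C hC using fun i => (hU i).2
  choose δ hδ hball using fun i => (hU i).1.2 _ (hC i)
  have hCK : ∀ i, C i ∈ Kc X := fun i => (hU i).1.1 (hC i)
  obtain ⟨n, D, hD⟩ := h k C (fun i => δ i / 2) hCK fun i => half_pos (hδ i)
  refine ⟨n, fun i => ?_⟩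
  obtain ⟨hfin, hne, hCD, hDC, hlt⟩ := hD i
  have hDU : D i ∈ U i := by
    refine hball i _ ⟨hfin.isCompact, hne⟩ (lt_of_le_of_lt ?_ (half_lt_self (hδ i)))
    rw [dH_of_nonempty (hCK i).2 hne]
    exact hausdorffDist_le_of_mem_dist (half_pos (hδ i)).le hCD hDC
  refine lt_diamIn dH_le_diam_univ (mem_image_of_mem _ (hC i)) (mem_image_of_mem _ hDU) ?_
  rwa [← Set.image_iterate_eq]

theorem MultiSensitiveOn.of_image (h : MultiSensitiveOn (Kc X) dH (Set.image f)) :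
    MultiSensitiveOn (univ : Set X) dist f := by
  obtain ⟨ε, hε, h⟩ := h
  refine ⟨ε / 2, half_pos hε, fun k U hU => ?_⟩
  obtain ⟨n, hn⟩ := h k (fun i => {A | A ∈ Kc X ∧ A ⊆ U i}) fun i => by
    refine ⟨⟨fun A hA => hA.1, fun A hA => ?_⟩, ?_⟩
    · obtain ⟨δ, hδ, hsub⟩ := hA.1.1.exists_thickening_subset_open (hU i).1.isOpen hA.2
      refine ⟨δ, hδ, fun B hB hAB => ⟨hB, fun y hy => hsub (Metric.mem_thickening_iff.2 ?_)⟩⟩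
      obtain ⟨x, hx, hxy⟩ := exists_dist_lt_of_dH_lt hA.1.2 hB.2 hAB hy
      exact ⟨x, hx, by rwa [dist_comm]⟩
    · obtain ⟨x, hx⟩ := (hU i).2
      exact ⟨{x}, ⟨isCompact_singleton, singleton_nonempty x⟩, singleton_subset_iff.2 hx⟩
  refine ⟨n, fun i => ?_⟩
  obtain ⟨_, ⟨A, hA, rfl⟩, _, ⟨B, hB, rfl⟩, hlt⟩ := exists_of_lt_diamIn hε (hn i)
  rw [← Set.image_iterate_eq] at hlt
  exact half_lt_diamIn_of_lt_dH (hA.1.2.image _) (hB.1.2.image _) (image_mono hA.2)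
    (image_mono hB.2) hε hlt

theorem MultiSensitiveOn.fuzz (h : MultiSensitiveOn (univ : Set X) dist f) (hf : Continuous f)
    {g : ℝ → ℝ} (hg : Dm g) (hg1 : ∀ t ∈ I01, (g t = 1 ↔ t = 1)) :
    MultiSensitiveOn {A : X → ℝ | InF1 A} dInfty (fuzz f g) := by
  obtain ⟨ε, hε, h⟩ := h.exists_finite_approx
  refine ⟨ε, hε, fun k U hU => ?_⟩
  choose A hA using fun i => (hU i).2
  choose δ hδ hball using fun i => (hU i).1.2 _ (hA i)
  have hA1 : ∀ i, InF1 (A i) := fun i => (hU i).1.1 (hA i)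
  obtain ⟨n, D, hD⟩ := h k (fun i => cut (A i) 1) (fun i => δ i / 4)
    (fun i => ⟨((hA1 i).1.isClosed_cut 1).isCompact, (hA1 i).cut_nonempty le_rfl⟩)
    fun i => by linarith [hδ i]
  refine ⟨n, fun i => ?_⟩
  obtain ⟨hfin, hne, hCD, hDC, hlt⟩ := hD i
  obtain ⟨c, hc, hcut⟩ := (hA1 i).exists_cut_near_cut_one (by linarith [hδ i] : 0 < δ i / 4)
  have hB1 := (hA1 i).capRaise hc.1 hfin.isClosed hne
  have hBU : capRaise (A i) c (D i) ∈ U i := by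
    refine hball i _ hB1 (lt_of_le_of_lt (dInfty_le fun α hα => ?_) (half_lt_self (hδ i)))
    rw [dH_of_nonempty ((hA1 i).cut_nonempty hα.2) (hB1.cut_nonempty hα.2)]
    refine hausdorffDist_le_of_mem_dist (half_pos (hδ i)).le (fun x hx => ?_) fun x hx => ?_
    · by_cases hαc : α ≤ c
      · refine ⟨x, le_capRaise_iff.2 ?_, by simpa using (half_pos (hδ i)).le⟩
        by_cases hxD : x ∈ D i
        exacts [Or.inl ⟨hxD, hα.2⟩, Or.inr ⟨hxD, hx, hαc⟩]
      · obtain ⟨y, hy, hxy⟩ := hcut x ((not_le.1 hαc).trans_le hx)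
        obtain ⟨d, hd, hyd⟩ := hCD y hy
        exact ⟨d, le_capRaise_iff.2 (Or.inl ⟨hd, hα.2⟩), by linarith [dist_triangle x y d]⟩
    · rcases le_capRaise_iff.1 hx with ⟨hxD, -⟩ | ⟨-, hxA, -⟩
      · obtain ⟨y, hy, hxy⟩ := hDC x hxD
        exact ⟨y, hα.2.trans hy, by linarith [hδ i]⟩
      · exact ⟨x, hxA, by simpa using (half_pos (hδ i)).le⟩
  have hcutB : cut (capRaise (A i) c (D i)) 1 = D i := by
    ext x
    simp [cut, le_capRaise_iff, hc.2]
  refine lt_diamIn dInfty_le_diam_univ (mem_image_of_mem _ (hA i)) (mem_image_of_mem _ hBU)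
    (lt_of_lt_of_le ?_ (dH_cut_le_dInfty _ _ (right_mem_Ioc.2 one_pos)))
  rwa [cut_one_iterate_fuzz hf hg hg1 (hA1 i), cut_one_iterate_fuzz hf hg hg1 hB1, hcutB]

theorem MultiSensitiveOn.of_fuzz (hf : Continuous f) {g : ℝ → ℝ} (hg : Dm g)
    (h : MultiSensitiveOn {A : X → ℝ | InF1 A} dInfty (_root_.fuzz f g)) :
    MultiSensitiveOn (univ : Set X) dist f := by
  obtain ⟨ε, hε, h⟩ := h
  refine ⟨ε / 2, half_pos hε, fun k U hU => ?_⟩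
  obtain ⟨n, hn⟩ := h k (fun i => {A | InF1 A ∧ supp A ⊆ U i}) fun i => by
    refine ⟨⟨fun A hA => hA.1, fun A hA => ?_⟩, ?_⟩
    · obtain ⟨δ, hδ, hsub⟩ := isClosed_closure.isCompact.exists_cthickening_subset_open
        (hU i).1.isOpen hA.2
      refine ⟨δ, hδ, fun B hB hAB => ⟨hB, (closure_minimal (fun y hy => ?_)
        Metric.isClosed_cthickening).trans hsub⟩⟩
      have hyI : B y ∈ Set.Ioc (0:ℝ) 1 := ⟨hy, (hB.1.2 y).2⟩
      obtain ⟨x, hx, hxy⟩ := exists_dist_lt_of_dH_lt (hA.1.cut_nonempty hyI.2)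
        (hB.cut_nonempty hyI.2) ((dH_cut_le_dInfty A B hyI).trans_lt hAB) (le_refl (B y))
      refine Metric.mem_cthickening_of_dist_le y x δ _ (subset_closure ?_) ?_
      · exact hyI.1.trans_le hx
      · rw [dist_comm]
        exact hxy.le
    · obtain ⟨x, hx⟩ := (hU i).2
      refine ⟨_, inF1_indicator_singleton x, ?_⟩
      refine (closure_minimal (fun y hy => ?_) isClosed_singleton).trans (singleton_subset_iff.2 hx)
      exact Set.mem_of_indicator_ne_zero (ne_of_gt (mem_ofPred.1 hy))
  refine ⟨n, fun i => ?_⟩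
  obtain ⟨_, ⟨A, hA, rfl⟩, _, ⟨B, hB, rfl⟩, hlt⟩ := exists_of_lt_diamIn hε (hn i)
  obtain ⟨α, hα, hlt⟩ := exists_lt_dH_cut_of_lt_dInfty hlt
  have hsub : ∀ A : X → ℝ, InF1 A → supp A ⊆ U i →
      cut ((_root_.fuzz f g)^[n] A) α ⊆ f^[n] '' U i := by
    intro A hA hAU x hx
    obtain ⟨z, hz, hpos⟩ := exists_pos_of_iterate_fuzz_pos hf hg hA n (hα.1.trans_le hx)
    exact ⟨z, hAU (subset_closure hpos), hz⟩
  exact half_lt_diamIn_of_lt_dH ((hA.1.iterate_fuzz hf hg n).cut_nonempty hα.2)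
    ((hB.1.iterate_fuzz hf hg n).cut_nonempty hα.2) (hsub A hA.1 hA.2) (hsub B hB.1 hB.2) hε hlt

end MultiSensitive

/-- TFAE: (1) `(X,f)` is multi-sensitive; (2) `(K(X), f̄)` is
multi-sensitive; (3) `(F^1(X), f̃_g)` is multi-sensitive for some `g ∈ D_m(I)`
with `g⁻¹(1) = {1}`; (4) the same for every such `g`. -/
theorem stmt13 {X : Type*} [MetricSpace X] [CompactSpace X]
    (f : X → X) (hf : Continuous f) :
    List.TFAE
      [MultiSensitiveOn (Set.univ : Set X) dist f,
       MultiSensitiveOn (Kc X) dH (Set.image f),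
       ∃ g : ℝ → ℝ, Dm g ∧ (∀ t ∈ I01, (g t = 1 ↔ t = 1)) ∧
         MultiSensitiveOn {A : X → ℝ | InF1 A} dInfty (fuzz f g),
       ∀ g : ℝ → ℝ, Dm g → (∀ t ∈ I01, (g t = 1 ↔ t = 1)) →
         MultiSensitiveOn {A : X → ℝ | InF1 A} dInfty (fuzz f g)] := by
  tfae_have 1 → 2 := fun h => h.image
  tfae_have 2 → 1 := MultiSensitiveOn.of_image
  tfae_have 1 → 4 := fun h g hg hg1 => h.fuzz hf hg hg1
  tfae_have 4 → 3 := fun h => ⟨id, dm_id, fun _ _ => Iff.rfl, h id dm_id fun _ _ => Iff.rfl⟩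
  tfae_have 3 → 1 := fun ⟨g, hg, _, h⟩ => MultiSensitiveOn.of_fuzz hf hg h
  tfae_finish
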